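/- Let K < 0, let x⁽¹⁾, …, x⁽ᵗ⁾ ∈ ℝ^{n+1} lie on the positive sheet of the hyperboloid of curvature K (i.e. ⟨x⁽ˡ⁾, x⁽ˡ⁾⟩_L = 1/K and x⁽ˡ⁾₀ > 0), and let w₁, …, w_t > 0. Define the Fréchet objective f(y) = Σ_{l=1}^t (w_l/|K|)·arcosh(K·⟨x⁽ˡ⁾, y⟩_L)² on the positive sheet. Define the iteration: y₀ = x⁽¹⁾, and for k ≥ 0, u_{k+1} = Σ_{l=1}^t w_l·φ(−|K|·⟨x⁽ˡ⁾, y_k⟩_L)·x⁽ˡ⁾ and y_{k+1} = u_{k+1} / √(−|K|·⟨u_{k+1}, u_{k+1}⟩_L), where φ(v) = 2·arcosh(v)/√(v² − 1) for v > 1 and φ(1) = 2. Suppose f attains its minimum over the positive sheet at a unique point μ. Then every y_k lies on the positive sheet, the iteration is well defined, and lim_{k→∞} y_k = μ. -/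

import Mathlib

open Filter

/-- The Lorentzian inner product on `ℝ^{n+1}` (coordinates indexed `0, 1, …, n`):
`⟨x, y⟩_L = −x₀y₀ + ∑_{i=1}^n xᵢyᵢ`. -/
def lorentzInner {n : ℕ} (x y : Fin (n + 1) → ℝ) : ℝ :=
  -(x 0 * y 0) + ∑ i : Fin n, x i.succ * y i.succ

/-- The inverse hyperbolic cosine, `arcosh x = log (x + √(x² − 1))` for `x ≥ 1`. -/
noncomputable def arcosh (x : ℝ) : ℝ := Real.log (x + Real.sqrt (x ^ 2 - 1))

/-- The continuous extension of `v ↦ 2 arcosh v / √(v² − 1)` to `v = 1`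
(its value for `v ≤ 1` is irrelevant; it is only used for `v ≥ 1`). -/
noncomputable def phiH (v : ℝ) : ℝ :=
  if v ≤ 1 then 2 else 2 * arcosh v / Real.sqrt (v ^ 2 - 1)

theorem arcosh_eq_real_arcosh : arcosh = Real.arcosh := rfl

theorem sq_arcosh_cosh (t : ℝ) : arcosh (Real.cosh t) ^ 2 = t ^ 2 := by
  rw [← Real.cosh_abs, arcosh_eq_real_arcosh, Real.arcosh_cosh (abs_nonneg t), sq_abs]

theorem phiH_of_le_one {v : ℝ} (hv : v ≤ 1) : phiH v = 2 := if_pos hv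

theorem phiH_of_one_lt {v : ℝ} (hv : 1 < v) :
    phiH v = 2 * arcosh v / Real.sqrt (v ^ 2 - 1) := if_neg hv.not_ge

theorem phiH_cosh {t : ℝ} (ht : 0 < t) : phiH (Real.cosh t) = 2 * t / Real.sinh t := by
  rw [phiH_of_one_lt (Real.one_lt_cosh.2 ht.ne'), arcosh_eq_real_arcosh,
    Real.arcosh_cosh ht.le, ← Real.sinh_sq, Real.sqrt_sq (Real.sinh_nonneg_iff.2 ht.le)]

theorem phiH_pos (v : ℝ) : 0 < phiH v := by
  rcases le_or_gt v 1 with hv | hv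
  · rw [phiH_of_le_one hv]; norm_num
  · rw [phiH_of_one_lt hv]
    have h1 : 0 < arcosh v := Real.arcosh_pos hv
    have h2 : 0 < v ^ 2 - 1 := by nlinarith
    positivity

theorem continuousOn_phiH : ContinuousOn phiH (Set.Ici 1) := by
  have hs : Continuous (dslope Real.sinh 0) := by
    rw [← continuousOn_univ, continuousOn_dslope univ_mem]
    exact ⟨Real.continuous_sinh.continuousOn, Real.differentiable_sinh 0⟩
  have hne : ∀ t : ℝ, 0 ≤ t → dslope Real.sinh 0 t ≠ 0 := by
    intro t ht
    rcases ht.eq_or_lt with rfl | ht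
    · simp
    · rw [dslope_of_ne _ ht.ne', slope_def_field]
      simp [Real.sinh_zero, ht.ne']
  have heq : Set.EqOn phiH (fun v => 2 / dslope Real.sinh 0 (Real.arcosh v)) (Set.Ici 1) := by
    intro v hv
    rcases (Set.mem_Ici.1 hv).eq_or_lt with rfl | hv'
    · simp [phiH_of_le_one]
    · have h1 := Real.arcosh_pos hv'
      have h2 := phiH_cosh h1
      rw [Real.cosh_arcosh hv] at h2
      simp only
      rw [h2, dslope_of_ne _ h1.ne', slope_def_field, Real.sinh_zero, sub_zero, sub_zero,
        div_div_eq_mul_div]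
  refine ContinuousOn.congr ?_ heq
  exact continuousOn_const.div (hs.comp_continuousOn Real.continuousOn_arcosh)
    fun v hv => hne _ (Real.arcosh_nonneg hv)

theorem convexOn_sinh : ConvexOn ℝ (Set.Ici 0) Real.sinh := by
  refine MonotoneOn.convexOn_of_deriv (convex_Ici 0) Real.continuous_sinh.continuousOn
    Real.differentiable_sinh.differentiableOn ?_
  rw [Real.deriv_sinh, interior_Ici]
  exact Real.cosh_strictMonoOn.monotoneOn.mono Set.Ioi_subset_Ici_self

theorem antitoneOn_phiH : AntitoneOn phiH (Set.Ioi 1) := by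
  intro a ha b hb hab
  have hsb := Real.arcosh_pos hb
  have hsa := Real.arcosh_pos ha
  have hst : Real.arcosh a ≤ Real.arcosh b :=
    (Real.arcosh_le_arcosh (zero_lt_one.trans ha) (zero_lt_one.trans hb)).2 hab
  rw [← Real.cosh_arcosh (le_of_lt ha), ← Real.cosh_arcosh (le_of_lt hb), phiH_cosh hsa,
    phiH_cosh hsb, div_le_div_iff₀ (Real.sinh_pos_iff.2 hsb) (Real.sinh_pos_iff.2 hsa)]
  generalize Real.arcosh a = s at *
  generalize Real.arcosh b = t at *
  have h := convexOn_sinh.2 (Set.mem_Ici.2 hsb.le) (Set.mem_Ici.2 le_rfl)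
    (div_nonneg hsa.le hsb.le) (sub_nonneg.2 ((div_le_one hsb).2 hst)) (by ring)
  simp only [smul_eq_mul, mul_zero, add_zero, Real.sinh_zero, div_mul_cancel₀ _ hsb.ne'] at h
  rw [div_mul_eq_mul_div, le_div_iff₀ hsb] at h
  linarith

theorem continuousOn_sq_arcosh : ContinuousOn (fun v => arcosh v ^ 2) (Set.Ici 1) :=
  Real.continuousOn_arcosh.pow 2

theorem hasDerivAt_sq_arcosh {v : ℝ} (hv : 1 < v) :
    HasDerivAt (fun v => arcosh v ^ 2) (phiH v) v := by
  have h : HasDerivAt (fun v => arcosh v ^ 2) _ v := (Real.hasDerivAt_arcosh hv).pow 2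
  rw [phiH_of_one_lt hv, div_eq_mul_inv]
  simpa [arcosh_eq_real_arcosh] using h

theorem concaveOn_sq_arcosh : ConcaveOn ℝ (Set.Ici 1) (fun v => arcosh v ^ 2) := by
  refine AntitoneOn.concaveOn_of_deriv (convex_Ici 1) continuousOn_sq_arcosh ?_ ?_
  all_goals rw [interior_Ici]
  · exact fun v hv => (hasDerivAt_sq_arcosh hv).differentiableAt.differentiableWithinAt
  · exact antitoneOn_phiH.congr fun v hv => (hasDerivAt_sq_arcosh hv).deriv.symm

theorem sq_arcosh_le_add_phiH_mul {a v : ℝ} (ha : 1 ≤ a) (hv : 1 ≤ v) :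
    arcosh v ^ 2 ≤ arcosh a ^ 2 + phiH a * (v - a) := by
  rcases ha.eq_or_lt with rfl | ha'
  · have h1 : arcosh 1 = 0 := Real.arcosh_zero
    have h0 : 0 ≤ arcosh v := Real.arcosh_nonneg hv
    have h2 : Real.cosh (arcosh v) = v := Real.cosh_arcosh hv
    rw [phiH_of_le_one le_rfl, h1]
    have h3 : Real.cosh (arcosh v) = 1 + 2 * Real.sinh (arcosh v / 2) ^ 2 := by
      have := Real.cosh_two_mul (arcosh v / 2)
      rw [mul_div_cancel₀ _ two_ne_zero, Real.cosh_sq] at this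
      linarith
    have h4 : arcosh v / 2 ≤ Real.sinh (arcosh v / 2) :=
      Real.self_le_sinh_iff.2 (by positivity)
    nlinarith
  · rcases lt_trichotomy a v with h | rfl | h
    · have := concaveOn_sq_arcosh.slope_le_of_hasDerivAt ha hv h (hasDerivAt_sq_arcosh ha')
      rw [slope_def_field, div_le_iff₀ (sub_pos.2 h)] at this
      linarith
    · simp
    · have := concaveOn_sq_arcosh.le_slope_of_hasDerivAt hv ha h (hasDerivAt_sq_arcosh ha')
      rw [slope_def_field, le_div_iff₀ (sub_pos.2 h)] at this
      linarith

/-- A comparison inequality of hyperbolic law-of-cosines type: `a`, `b`, `v` are the hyperbolic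
cosines of the pairwise distances of three points. -/
theorem sq_arcosh_add_phiH_mul_le {a b v : ℝ} (ha : 1 ≤ a) (hb : 1 < b)
    (h : (v - a * b) ^ 2 ≤ (a ^ 2 - 1) * (b ^ 2 - 1)) :
    arcosh a ^ 2 + phiH a * (arcosh b / Real.sinh (arcosh b)) * (v - a * b) ≤ arcosh v ^ 2 := by
  obtain ⟨s, hs, rfl⟩ : ∃ s, 0 < s ∧ Real.cosh s = b :=
    ⟨_, Real.arcosh_pos hb, Real.cosh_arcosh hb.le⟩
  rw [arcosh_eq_real_arcosh, Real.arcosh_cosh hs.le, ← arcosh_eq_real_arcosh]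
  have hss := Real.sinh_pos_iff.2 hs
  rcases ha.eq_or_lt with rfl | ha'
  · have : v = Real.cosh s := by nlinarith
    subst this
    have h1 : arcosh 1 = 0 := Real.arcosh_zero
    simpa [h1] using sq_nonneg _
  obtain ⟨r, hr, rfl⟩ : ∃ r, 0 < r ∧ Real.cosh r = a :=
    ⟨_, Real.arcosh_pos ha', Real.cosh_arcosh ha⟩
  have hrr := Real.sinh_pos_iff.2 hr
  rw [sq_arcosh_cosh, phiH_cosh hr]
  rw [← Real.sinh_sq, ← Real.sinh_sq, ← mul_pow] at h
  have hrs : 0 < Real.sinh r * Real.sinh s := mul_pos hrr hss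
  obtain ⟨h1, h2⟩ := abs_le_of_sq_le_sq' h hrs.le
  obtain ⟨β, hβ⟩ : ∃ β, v - Real.cosh r * Real.cosh s = β * (Real.sinh r * Real.sinh s) :=
    ⟨(v - Real.cosh r * Real.cosh s) / (Real.sinh r * Real.sinh s), by field_simp⟩
  rw [hβ] at h1 h2
  have hβ1 : -1 ≤ β := by
    by_contra! hc
    nlinarith
  have hβ2 : β ≤ 1 := by
    by_contra! hc
    nlinarith
  have hv : v = (1 + β) / 2 * Real.cosh (r + s) + (1 - β) / 2 * Real.cosh (r - s) := by
    rw [Real.cosh_add, Real.cosh_sub]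
    linarith
  have hc := concaveOn_sq_arcosh.2 (Set.mem_Ici.2 (Real.one_le_cosh (r + s)))
    (Set.mem_Ici.2 (Real.one_le_cosh (r - s)))
    (show 0 ≤ (1 + β) / 2 by linarith) (show 0 ≤ (1 - β) / 2 by linarith) (by ring)
  simp only [smul_eq_mul, sq_arcosh_cosh] at hc
  rw [← hv] at hc
  have he : 2 * r / Real.sinh r * (s / Real.sinh s) * (v - Real.cosh r * Real.cosh s)
      = 2 * r * s * β := by
    rw [hβ]; field_simp
  rw [he]
  nlinarith [sq_nonneg s]

section Lorentz

variable {n : ℕ}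

theorem lorentzInner_comm (p q : Fin (n + 1) → ℝ) : lorentzInner p q = lorentzInner q p := by
  simp [lorentzInner, mul_comm]

theorem lorentzInner_add_left (p p' q : Fin (n + 1) → ℝ) :
    lorentzInner (p + p') q = lorentzInner p q + lorentzInner p' q := by
  simp only [lorentzInner, Pi.add_apply, add_mul, Finset.sum_add_distrib]
  ring

theorem lorentzInner_smul_left (a : ℝ) (p q : Fin (n + 1) → ℝ) :
    lorentzInner (a • p) q = a * lorentzInner p q := by
  simp only [lorentzInner, Pi.smul_apply, smul_eq_mul, mul_add, Finset.mul_sum, mul_assoc]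
  ring

theorem lorentzInner_add_right (p q q' : Fin (n + 1) → ℝ) :
    lorentzInner p (q + q') = lorentzInner p q + lorentzInner p q' := by
  simp only [lorentzInner_comm p, lorentzInner_add_left]

theorem lorentzInner_smul_right (a : ℝ) (p q : Fin (n + 1) → ℝ) :
    lorentzInner p (a • q) = a * lorentzInner p q := by
  simp only [lorentzInner_comm p, lorentzInner_smul_left]

theorem lorentzInner_sum_smul_left {ι : Type*} (s : Finset ι) (a : ι → ℝ)
    (x : ι → Fin (n + 1) → ℝ) (q : Fin (n + 1) → ℝ) :
    lorentzInner (∑ l ∈ s, a l • x l) q = ∑ l ∈ s, a l * lorentzInner (x l) q := by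
  classical
  induction s using Finset.induction_on with
  | empty => simp [lorentzInner]
  | insert i s hi ih =>
    rw [Finset.sum_insert hi, Finset.sum_insert hi, lorentzInner_add_left,
      lorentzInner_smul_left, ih]

theorem Continuous.lorentzInner {X : Type*} [TopologicalSpace X] {p q : X → Fin (n + 1) → ℝ}
    (hp : Continuous p) (hq : Continuous q) : Continuous fun z => lorentzInner (p z) (q z) := by
  unfold _root_.lorentzInner
  fun_prop

/-- Vectors orthogonal to a timelike vector are spacelike. -/
theorem lorentzInner_self_nonneg_of_orthogonal {z y : Fin (n + 1) → ℝ}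
    (hy : lorentzInner y y < 0) (hz : lorentzInner z y = 0) : 0 ≤ lorentzInner z z := by
  have hcs := Finset.sum_mul_sq_le_sq_mul_sq Finset.univ (fun i : Fin n => z i.succ)
    fun i => y i.succ
  have hY : 0 ≤ ∑ i : Fin n, y i.succ ^ 2 := Finset.sum_nonneg fun _ _ => sq_nonneg _
  have hZ : 0 ≤ ∑ i : Fin n, z i.succ ^ 2 := Finset.sum_nonneg fun _ _ => sq_nonneg _
  simp only [lorentzInner, ← sq] at *
  have h1 : ∑ i : Fin n, z i.succ * y i.succ = z 0 * y 0 := by linarith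
  rw [h1] at hcs
  by_contra! hc
  nlinarith

theorem lorentzInner_cauchy_schwarz_of_orthogonal {p q y : Fin (n + 1) → ℝ}
    (hy : lorentzInner y y < 0) (hp : lorentzInner p y = 0) (hq : lorentzInner q y = 0) :
    lorentzInner p q ^ 2 ≤ lorentzInner p p * lorentzInner q q := by
  have h : ∀ t : ℝ,
      0 ≤ lorentzInner q q * (t * t) + 2 * lorentzInner p q * t + lorentzInner p p := by
    intro t
    have h1 : lorentzInner (p + t • q) y = 0 := by
      rw [lorentzInner_add_left, lorentzInner_smul_left, hp, hq]; ring
    have h2 := lorentzInner_self_nonneg_of_orthogonal hy h1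
    simp only [lorentzInner_add_left, lorentzInner_smul_left, lorentzInner_add_right,
      lorentzInner_smul_right] at h2
    rw [lorentzInner_comm q p] at h2
    linarith
  have := discrim_le_zero h
  unfold discrim at this
  linarith

/-- The positive sheet of the hyperboloid of curvature `K`. -/
def positiveSheet (n : ℕ) (K : ℝ) : Set (Fin (n + 1) → ℝ) :=
  {y | lorentzInner y y = 1 / K ∧ 0 < y 0}

variable {K : ℝ}

theorem lorentzInner_gram_le {p q y : Fin (n + 1) → ℝ} (hK : K < 0)
    (hp : lorentzInner p p = 1 / K) (hq : lorentzInner q q = 1 / K)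
    (hy : lorentzInner y y = 1 / K) :
    (K * lorentzInner p q - K * lorentzInner p y * (K * lorentzInner y q)) ^ 2 ≤
      ((K * lorentzInner p y) ^ 2 - 1) * ((K * lorentzInner y q) ^ 2 - 1) := by
  have hy' : lorentzInner y y < 0 := hy ▸ one_div_neg.2 hK
  have hK0 := hK.ne
  have h := lorentzInner_cauchy_schwarz_of_orthogonal hy'
    (p := p + (-(K * lorentzInner p y)) • y) (q := q + (-(K * lorentzInner y q)) • y)
    (by rw [lorentzInner_add_left, lorentzInner_smul_left, hy]; field_simp; ring)
    (by rw [lorentzInner_add_left, lorentzInner_smul_left, hy, lorentzInner_comm q y]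
        field_simp; ring)
  simp only [lorentzInner_add_left, lorentzInner_smul_left, lorentzInner_add_right,
      lorentzInner_smul_right, hp, hq, hy, lorentzInner_comm q y, lorentzInner_comm y p] at h
  have h2 := mul_le_mul_of_nonneg_left h (sq_nonneg K)
  refine le_trans (le_of_eq ?_) (h2.trans_eq ?_) <;> (field_simp; ring)

theorem sq_sum_le_of_mem_positiveSheet {p q : Fin (n + 1) → ℝ} (hK : K < 0)
    (hp : p ∈ positiveSheet n K) (hq : q ∈ positiveSheet n K) :
    (∑ i : Fin n, p i.succ * q i.succ) ^ 2 ≤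
      (p 0 * q 0 + 1 / K) ^ 2 + 1 / K * (p 0 - q 0) ^ 2 ∧ 0 ≤ p 0 * q 0 + 1 / K := by
  have hcs := Finset.sum_mul_sq_le_sq_mul_sq Finset.univ (fun i : Fin n => p i.succ)
    fun i => q i.succ
  have hP : 0 ≤ ∑ i : Fin n, p i.succ ^ 2 := Finset.sum_nonneg fun _ _ => sq_nonneg _
  have hQ : 0 ≤ ∑ i : Fin n, q i.succ ^ 2 := Finset.sum_nonneg fun _ _ => sq_nonneg _
  obtain ⟨hp1, hp0⟩ := hp
  obtain ⟨hq1, hq0⟩ := hq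
  have hk : 1 / K < 0 := one_div_neg.2 hK
  simp only [lorentzInner, ← sq] at hp1 hq1
  generalize 1 / K = k at *
  have hP' : ∑ i : Fin n, p i.succ ^ 2 = k + p 0 ^ 2 := by linarith
  have hQ' : ∑ i : Fin n, q i.succ ^ 2 = k + q 0 ^ 2 := by linarith
  rw [hP'] at hcs hP
  rw [hQ'] at hcs hQ
  refine ⟨hcs.trans (le_of_eq (by ring)), ?_⟩
  have h1 : (-k) ^ 2 ≤ (p 0 * q 0) ^ 2 := by
    rw [mul_pow, sq (-k)]
    exact mul_le_mul (by linarith) (by linarith) (by linarith) (sq_nonneg _)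
  linarith [abs_le_of_sq_le_sq' h1 (mul_pos hp0 hq0).le]

theorem one_le_mul_lorentzInner {p q : Fin (n + 1) → ℝ} (hK : K < 0)
    (hp : p ∈ positiveSheet n K) (hq : q ∈ positiveSheet n K) : 1 ≤ K * lorentzInner p q := by
  obtain ⟨h1, h2⟩ := sq_sum_le_of_mem_positiveSheet hK hp hq
  have hk : 1 / K < 0 := one_div_neg.2 hK
  have h3 := (abs_le_of_sq_le_sq' (h1.trans
    (add_le_of_nonpos_right (mul_nonpos_of_nonpos_of_nonneg hk.le (sq_nonneg _)))) h2).2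
  have h4 : lorentzInner p q ≤ 1 / K := by
    unfold lorentzInner
    linarith
  rwa [le_div_iff_of_neg hK, mul_comm] at h4

theorem eq_of_mul_lorentzInner_le_one {p q : Fin (n + 1) → ℝ} (hK : K < 0)
    (hp : p ∈ positiveSheet n K) (hq : q ∈ positiveSheet n K) (h : K * lorentzInner p q ≤ 1) :
    p = q := by
  obtain ⟨h1, h2⟩ := sq_sum_le_of_mem_positiveSheet hK hp hq
  have hk : 1 / K < 0 := one_div_neg.2 hK
  have h3 : lorentzInner p q = 1 / K := by
    rw [eq_div_iff hK.ne, mul_comm]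
    exact h.antisymm (one_le_mul_lorentzInner hK hp hq)
  have h4 : ∑ i : Fin n, p i.succ * q i.succ = p 0 * q 0 + 1 / K := by
    unfold lorentzInner at h3
    linarith
  rw [h4] at h1
  have h5 : p 0 = q 0 := by
    have : (p 0 - q 0) ^ 2 ≤ 0 := by nlinarith
    nlinarith
  have h6 : ∑ i : Fin n, (p i.succ - q i.succ) ^ 2 = 0 := by
    obtain ⟨hp1, hp0⟩ := hp
    obtain ⟨hq1, hq0⟩ := hq
    simp only [lorentzInner, ← sq] at hp1 hq1
    simp only [sub_sq, Finset.sum_add_distrib, Finset.sum_sub_distrib, mul_assoc,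
      ← Finset.mul_sum, h4, h5] at hp1 hq1 ⊢
    linarith
  rw [Finset.sum_eq_zero_iff_of_nonneg fun _ _ => sq_nonneg _] at h6
  funext i
  refine Fin.cases h5 (fun j => ?_) i
  exact sub_eq_zero.1 (pow_eq_zero_iff two_ne_zero |>.1 (h6 j (Finset.mem_univ j)))

theorem sum_smul_timelike {ι : Type*} [Fintype ι] [Nonempty ι] (hK : K < 0)
    {x : ι → Fin (n + 1) → ℝ} (hx : ∀ l, x l ∈ positiveSheet n K) {a : ι → ℝ}
    (ha : ∀ l, 0 < a l) :
    lorentzInner (∑ l, a l • x l) (∑ l, a l • x l) < 0 ∧ 0 < (∑ l, a l • x l) 0 := by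
  have hneg : ∀ l m, lorentzInner (x l) (x m) < 0 := fun l m => by
    have := one_le_mul_lorentzInner hK (hx l) (hx m)
    by_contra! hc
    nlinarith
  constructor
  · rw [lorentzInner_sum_smul_left]
    refine Finset.sum_neg (fun l _ => mul_neg_of_pos_of_neg (ha l) ?_) Finset.univ_nonempty
    rw [lorentzInner_comm, lorentzInner_sum_smul_left]
    exact Finset.sum_neg (fun m _ => mul_neg_of_pos_of_neg (ha m) (hneg m l))
      Finset.univ_nonempty
  · simp only [Finset.sum_apply, Pi.smul_apply, smul_eq_mul]
    exact Finset.sum_pos (fun l _ => mul_pos (ha l) (hx l).2) Finset.univ_nonempty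

theorem normalize_mem_positiveSheet (hK : K < 0) {u : Fin (n + 1) → ℝ}
    (hu : lorentzInner u u < 0) (hu0 : 0 < u 0) :
    (Real.sqrt (-(|K| * lorentzInner u u)))⁻¹ • u ∈ positiveSheet n K := by
  have hpos : 0 < -(|K| * lorentzInner u u) := by
    rw [abs_of_neg hK]; nlinarith
  refine ⟨?_, ?_⟩
  · rw [lorentzInner_smul_left, lorentzInner_smul_right, ← mul_assoc, ← mul_inv,
      Real.mul_self_sqrt hpos.le, abs_of_neg hK]
    have := hK.ne
    have := hu.ne
    field_simp
  · exact mul_pos (inv_pos.2 (Real.sqrt_pos.2 hpos)) hu0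

theorem isCompact_sheet_inter {p : Fin (n + 1) → ℝ} (hK : K < 0) (hp : p ∈ positiveSheet n K)
    (B : ℝ) : IsCompact {y ∈ positiveSheet n K | K * lorentzInner p y ≤ B} := by
  have hk : 1 / K < 0 := one_div_neg.2 hK
  have heq : {y ∈ positiveSheet n K | K * lorentzInner p y ≤ B} =
      {y | lorentzInner y y = 1 / K} ∩ {y | 0 ≤ y 0} ∩ {y | K * lorentzInner p y ≤ B} := by
    ext y
    refine ⟨fun h => ⟨⟨h.1.1, h.1.2.le⟩, h.2⟩, fun h => ⟨⟨h.1.1, ?_⟩, h.2⟩⟩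
    refine lt_of_le_of_ne h.1.2 fun h0 => ?_
    have h1 : lorentzInner y y = 1 / K := h.1.1
    have hY : 0 ≤ ∑ i : Fin n, y i.succ * y i.succ :=
      Finset.sum_nonneg fun _ _ => mul_self_nonneg _
    simp only [lorentzInner, ← h0] at h1
    linarith
  have hclosed : IsClosed {y ∈ positiveSheet n K | K * lorentzInner p y ≤ B} := by
    rw [heq]
    refine ((isClosed_eq (continuous_id.lorentzInner continuous_id) continuous_const).inter
      (isClosed_le continuous_const (continuous_apply 0))).inter
      (isClosed_le (continuous_const.mul (continuous_const.lorentzInner continuous_id))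
        continuous_const)
  set r := Real.sqrt (∑ i : Fin n, p i.succ ^ 2) with hr
  have hrp : r < p 0 := by
    rw [hr, Real.sqrt_lt' hp.2]
    have := hp.1
    simp only [lorentzInner, ← sq] at this
    linarith
  set R := (B / -K) / (p 0 - r)
  refine (isCompact_Icc (a := fun _ => -R) (b := fun _ => R)).of_isClosed_subset hclosed ?_
  rintro y ⟨hy, hyB⟩
  have hy1 := hy.1
  simp only [lorentzInner, ← sq] at hy1
  have hys : Real.sqrt (∑ i : Fin n, y i.succ ^ 2) ≤ y 0 := by
    rw [Real.sqrt_le_left hy.2.le]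
    linarith
  have hcs := Real.sum_mul_le_sqrt_mul_sqrt Finset.univ (fun i : Fin n => p i.succ)
    fun i => y i.succ
  have h1 := mul_le_mul_of_nonneg_left hys (Real.sqrt_nonneg (∑ i : Fin n, p i.succ ^ 2))
  have h2 : -lorentzInner p y ≤ B / -K := by
    rw [le_div_iff₀ (neg_pos.2 hK)]
    linarith
  have hR : y 0 ≤ R := by
    rw [le_div_iff₀ (sub_pos.2 hrp)]
    unfold lorentzInner at h2
    rw [← hr] at hcs h1
    linarith
  have hi : ∀ i, |y i| ≤ R := by
    refine Fin.cases ((abs_of_pos hy.2).trans_le hR) fun j => le_trans ?_ hR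
    refine le_trans (Real.abs_le_sqrt ?_) hys
    exact Finset.single_le_sum (f := fun i : Fin n => y i.succ ^ 2)
      (fun _ _ => sq_nonneg _) (Finset.mem_univ j)
  exact ⟨fun i => (abs_le.1 (hi i)).1, fun i => (abs_le.1 (hi i)).2⟩

end Lorentz

section FrechetMean

variable {n : ℕ} {ι : Type*} [Fintype ι] {K : ℝ} {x : ι → Fin (n + 1) → ℝ} {w : ι → ℝ}

/-- The weighted Fréchet objective. -/
noncomputable def frechetObjective (K : ℝ) (x : ι → Fin (n + 1) → ℝ) (w : ι → ℝ)
    (y : Fin (n + 1) → ℝ) : ℝ :=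
  ∑ l, (w l / |K|) * (arcosh (K * lorentzInner (x l) y)) ^ 2

/-- The reweighted sum of the data points, before normalization. -/
noncomputable def frechetDirection (K : ℝ) (x : ι → Fin (n + 1) → ℝ) (w : ι → ℝ)
    (y : Fin (n + 1) → ℝ) : Fin (n + 1) → ℝ :=
  ∑ l, (w l * phiH (-(|K| * lorentzInner (x l) y))) • x l

/-- Rescaling of a timelike vector to the hyperboloid of curvature `K`. -/
noncomputable def hyperboloidNormalize (K : ℝ) (u : Fin (n + 1) → ℝ) : Fin (n + 1) → ℝ :=
  (Real.sqrt (-(|K| * lorentzInner u u)))⁻¹ • u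

theorem neg_abs_mul_lorentzInner (hK : K < 0) (p q : Fin (n + 1) → ℝ) :
    -(|K| * lorentzInner p q) = K * lorentzInner p q := by
  rw [abs_of_neg hK]; ring

theorem frechetDirection_timelike [Nonempty ι] (hK : K < 0) (hx : ∀ l, x l ∈ positiveSheet n K)
    (hw : ∀ l, 0 < w l) (y : Fin (n + 1) → ℝ) :
    lorentzInner (frechetDirection K x w y) (frechetDirection K x w y) < 0 ∧
      0 < frechetDirection K x w y 0 :=
  sum_smul_timelike hK hx fun l => mul_pos (hw l) (phiH_pos _)

theorem frechetDirection_eq_smul_normalize [Nonempty ι] (hK : K < 0)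
    (hx : ∀ l, x l ∈ positiveSheet n K) (hw : ∀ l, 0 < w l) (y : Fin (n + 1) → ℝ) :
    ∃ r : ℝ, 0 < r ∧ frechetDirection K x w y =
      r • hyperboloidNormalize K (frechetDirection K x w y) := by
  have hu := (frechetDirection_timelike hK hx hw y).1
  have hpos : 0 < -(|K| * lorentzInner (frechetDirection K x w y) (frechetDirection K x w y)) := by
    rw [abs_of_neg hK]; nlinarith
  have h := Real.sqrt_pos.2 hpos
  exact ⟨_, h, by rw [hyperboloidNormalize, smul_smul, mul_inv_cancel₀ h.ne', one_smul]⟩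

theorem normalize_frechetDirection_mem [Nonempty ι] (hK : K < 0)
    (hx : ∀ l, x l ∈ positiveSheet n K) (hw : ∀ l, 0 < w l) (y : Fin (n + 1) → ℝ) :
    hyperboloidNormalize K (frechetDirection K x w y) ∈ positiveSheet n K :=
  have h := frechetDirection_timelike hK hx hw y
  normalize_mem_positiveSheet hK h.1 h.2

theorem continuousOn_frechetObjective (hK : K < 0) (hx : ∀ l, x l ∈ positiveSheet n K) :
    ContinuousOn (frechetObjective K x w) (positiveSheet n K) := by
  refine continuousOn_finsetSum _ fun l _ => continuousOn_const.mul ?_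
  exact continuousOn_sq_arcosh.comp
    (continuous_const.mul (continuous_const.lorentzInner continuous_id)).continuousOn
    fun y hy => one_le_mul_lorentzInner hK (hx l) hy

theorem continuousOn_normalize_frechetDirection [Nonempty ι] (hK : K < 0)
    (hx : ∀ l, x l ∈ positiveSheet n K) (hw : ∀ l, 0 < w l) :
    ContinuousOn (fun y => hyperboloidNormalize K (frechetDirection K x w y))
      (positiveSheet n K) := by
  have hdir : ContinuousOn (frechetDirection K x w) (positiveSheet n K) := by
    refine continuousOn_finsetSum _ fun l _ => ?_
    refine ContinuousOn.smul (f := fun y => w l * phiH (-(|K| * lorentzInner (x l) y)))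
      (continuousOn_const.mul ?_) continuousOn_const
    refine continuousOn_phiH.comp
      (continuous_const.mul (continuous_const.lorentzInner continuous_id)).neg.continuousOn
      fun y hy => ?_
    rw [neg_abs_mul_lorentzInner hK]
    exact one_le_mul_lorentzInner hK (hx l) hy
  have hin : Continuous fun u : Fin (n + 1) → ℝ => Real.sqrt (-(|K| * lorentzInner u u)) :=
    (continuous_const.mul (continuous_id.lorentzInner continuous_id)).neg.sqrt
  refine ((hin.comp_continuousOn hdir).inv₀ fun y _ => ?_).smul hdir
  have hu := (frechetDirection_timelike hK hx hw y).1
  refine (Real.sqrt_pos.2 ?_).ne'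
  rw [abs_of_neg hK]; nlinarith

/-- Each step decreases the objective, strictly unless the point is fixed. -/
theorem frechetObjective_step_add_le [Nonempty ι] (hK : K < 0)
    (hx : ∀ l, x l ∈ positiveSheet n K) (hw : ∀ l, 0 < w l) {y : Fin (n + 1) → ℝ}
    (hy : y ∈ positiveSheet n K) :
    ∃ ρ : ℝ, 0 < ρ ∧ frechetObjective K x w (hyperboloidNormalize K (frechetDirection K x w y)) +
      ρ * (K * lorentzInner (hyperboloidNormalize K (frechetDirection K x w y)) y - 1) ≤
      frechetObjective K x w y := by
  obtain ⟨r, hr, hru⟩ := frechetDirection_eq_smul_normalize hK hx hw y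
  have hz := normalize_frechetDirection_mem hK hx hw y
  have hdir : ∀ q, lorentzInner (frechetDirection K x w y) q =
      ∑ l, w l * phiH (K * lorentzInner (x l) y) * lorentzInner (x l) q := fun q => by
    simp only [frechetDirection, lorentzInner_sum_smul_left, neg_abs_mul_lorentzInner hK]
  set z := hyperboloidNormalize K (frechetDirection K x w y)
  refine ⟨r / -K, div_pos hr (neg_pos.2 hK), ?_⟩
  have h1 : frechetObjective K x w z ≤ frechetObjective K x w y +
      ∑ l, w l / |K| * (phiH (K * lorentzInner (x l) y) *
        (K * lorentzInner (x l) z - K * lorentzInner (x l) y)) := by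
    rw [frechetObjective, frechetObjective, ← Finset.sum_add_distrib]
    refine Finset.sum_le_sum fun l _ => ?_
    rw [← mul_add]
    exact mul_le_mul_of_nonneg_left (sq_arcosh_le_add_phiH_mul
      (one_le_mul_lorentzInner hK (hx l) hy) (one_le_mul_lorentzInner hK (hx l) hz))
      (div_nonneg (hw l).le (abs_nonneg K))
  have h2 : ∑ l, w l / |K| * (phiH (K * lorentzInner (x l) y) *
        (K * lorentzInner (x l) z - K * lorentzInner (x l) y)) =
      -(r / -K * (K * lorentzInner z y - 1)) := by
    have h3 : ∑ l, w l / |K| * (phiH (K * lorentzInner (x l) y) *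
        (K * lorentzInner (x l) z - K * lorentzInner (x l) y)) =
        -(lorentzInner (frechetDirection K x w y) z -
          lorentzInner (frechetDirection K x w y) y) := by
      rw [hdir, hdir, ← Finset.sum_sub_distrib, ← Finset.sum_neg_distrib]
      refine Finset.sum_congr rfl fun l _ => ?_
      rw [abs_of_neg hK]
      have := hK.ne
      field_simp
    rw [h3, hru, lorentzInner_smul_left, lorentzInner_smul_left, hz.1]
    have := hK.ne
    field_simp
    ring
  linarith

/-- Fixed points of the iteration are global minimizers. -/
theorem frechetObjective_le_of_fixed [Nonempty ι] (hK : K < 0)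
    (hx : ∀ l, x l ∈ positiveSheet n K) (hw : ∀ l, 0 < w l) {y m : Fin (n + 1) → ℝ}
    (hy : y ∈ positiveSheet n K) (hm : m ∈ positiveSheet n K)
    (hfix : hyperboloidNormalize K (frechetDirection K x w y) = y) :
    frechetObjective K x w y ≤ frechetObjective K x w m := by
  rcases (one_le_mul_lorentzInner hK hy hm).eq_or_lt with hb | hb
  · rw [eq_of_mul_lorentzInner_le_one hK hy hm hb.ge]
  obtain ⟨r, hr, hru⟩ := frechetDirection_eq_smul_normalize hK hx hw y
  rw [hfix] at hru
  have hdir : ∀ q, lorentzInner (frechetDirection K x w y) q =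
      ∑ l, w l * phiH (K * lorentzInner (x l) y) * lorentzInner (x l) q := fun q => by
    simp only [frechetDirection, lorentzInner_sum_smul_left, neg_abs_mul_lorentzInner hK]
  set b := K * lorentzInner y m with hb_def
  set c := arcosh b / Real.sinh (arcosh b)
  have h1 : frechetObjective K x w y + ∑ l, w l / |K| * (phiH (K * lorentzInner (x l) y) * c *
      (K * lorentzInner (x l) m - K * lorentzInner (x l) y * b)) ≤ frechetObjective K x w m := by
    rw [frechetObjective, frechetObjective, ← Finset.sum_add_distrib]
    refine Finset.sum_le_sum fun l _ => ?_
    rw [← mul_add]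
    exact mul_le_mul_of_nonneg_left (sq_arcosh_add_phiH_mul_le
      (one_le_mul_lorentzInner hK (hx l) hy) hb
      (lorentzInner_gram_le hK (hx l).1 hm.1 hy.1)) (div_nonneg (hw l).le (abs_nonneg K))
  have h2 : ∑ l, w l / |K| * (phiH (K * lorentzInner (x l) y) * c *
      (K * lorentzInner (x l) m - K * lorentzInner (x l) y * b)) =
      -c * (lorentzInner (frechetDirection K x w y) m -
        b * lorentzInner (frechetDirection K x w y) y) := by
    rw [hdir, hdir, Finset.mul_sum, ← Finset.sum_sub_distrib, Finset.mul_sum]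
    refine Finset.sum_congr rfl fun l _ => ?_
    rw [abs_of_neg hK]
    have := hK.ne
    field_simp
  have h3 : lorentzInner (frechetDirection K x w y) m -
        b * lorentzInner (frechetDirection K x w y) y = 0 := by
    rw [hru, lorentzInner_smul_left, lorentzInner_smul_left, hy.1, hb_def]
    have := hK.ne
    field_simp
    ring
  rw [h2, h3, mul_zero, add_zero] at h1
  exact h1

theorem mul_lorentzInner_le_of_frechetObjective_le (hK : K < 0)
    (hx : ∀ l, x l ∈ positiveSheet n K) (hw : ∀ l, 0 < w l) (l : ι) {y : Fin (n + 1) → ℝ}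
    (hy : y ∈ positiveSheet n K) {M : ℝ} (hM : frechetObjective K x w y ≤ M) :
    K * lorentzInner (x l) y ≤ Real.cosh (Real.sqrt (M / (w l / |K|))) := by
  have hwK : ∀ l, 0 < w l / |K| := fun l => div_pos (hw l) (abs_pos.2 hK.ne)
  have h1 := (Finset.single_le_sum (f := fun l => w l / |K| *
    arcosh (K * lorentzInner (x l) y) ^ 2)
    (fun l _ => mul_nonneg (hwK l).le (sq_nonneg _)) (Finset.mem_univ l)).trans hM
  rw [← le_div_iff₀' (hwK l)] at h1
  have h2 : Real.cosh (arcosh (K * lorentzInner (x l) y)) = K * lorentzInner (x l) y :=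
    Real.cosh_arcosh (one_le_mul_lorentzInner hK (hx l) hy)
  rw [← h2, Real.cosh_le_cosh, abs_of_nonneg (Real.sqrt_nonneg _)]
  exact Real.abs_le_sqrt h1

theorem tendsto_frechet_iteration [Nonempty ι] (hK : K < 0)
    (hx : ∀ l, x l ∈ positiveSheet n K) (hw : ∀ l, 0 < w l) {μ : Fin (n + 1) → ℝ}
    (hμ : μ ∈ positiveSheet n K)
    (hmin : ∀ y ∈ positiveSheet n K, frechetObjective K x w y ≤ frechetObjective K x w μ → y = μ)
    {y : ℕ → Fin (n + 1) → ℝ} (hmem : ∀ k, y k ∈ positiveSheet n K)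
    (hstep : ∀ k, y (k + 1) = hyperboloidNormalize K (frechetDirection K x w (y k))) :
    Tendsto y atTop (nhds μ) := by
  obtain ⟨l⟩ := ‹Nonempty ι›
  have hle : ∀ k, frechetObjective K x w (y (k + 1)) ≤ frechetObjective K x w (y k) := fun k => by
    obtain ⟨ρ, hρ, h⟩ := frechetObjective_step_add_le hK hx hw (hmem k)
    rw [← hstep] at h
    have := mul_nonneg hρ.le
      (sub_nonneg.2 (one_le_mul_lorentzInner hK (hmem (k + 1)) (hmem k)))
    linarith
  have hanti : Antitone fun k => frechetObjective K x w (y k) := antitone_nat_of_succ_le hle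
  have hcomp := isCompact_sheet_inter hK (hx l)
    (Real.cosh (Real.sqrt (frechetObjective K x w (y 0) / (w l / |K|))))
  refine hcomp.tendsto_nhds_of_unique_mapClusterPt (Eventually.of_forall fun k => ⟨hmem k,
    mul_lorentzInner_le_of_frechetObjective_le hK hx hw l (hmem k) (hanti (Nat.zero_le k))⟩) ?_
  rintro z ⟨hz, -⟩ hcl
  obtain ⟨ψ, hψ, hlim⟩ := hcl.tendsto_subseq
  obtain ⟨L, hL⟩ : ∃ L, Tendsto (fun k => frechetObjective K x w (y k)) atTop (nhds L) := by
    refine ⟨_, tendsto_atTop_ciInf hanti ⟨0, ?_⟩⟩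
    rintro _ ⟨k, rfl⟩
    exact Finset.sum_nonneg fun l _ =>
      mul_nonneg (div_nonneg (hw l).le (abs_nonneg K)) (sq_nonneg _)
  have hcont := continuousOn_frechetObjective (w := w) hK hx
  have hzlim : Tendsto (y ∘ ψ) atTop (nhdsWithin z (positiveSheet n K)) :=
    tendsto_nhdsWithin_iff.2 ⟨hlim, Eventually.of_forall fun k => hmem _⟩
  have hfz : frechetObjective K x w z = L :=
    tendsto_nhds_unique ((hcont z hz).tendsto.comp hzlim) (hL.comp hψ.tendsto_atTop)
  set z' := hyperboloidNormalize K (frechetDirection K x w z) with hz'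
  have hz'mem : z' ∈ positiveSheet n K := normalize_frechetDirection_mem hK hx hw z
  have hlim' : Tendsto (fun k => y (ψ k + 1)) atTop (nhds z') := by
    simp only [hstep]
    exact (continuousOn_normalize_frechetDirection hK hx hw z hz).tendsto.comp hzlim
  have hfz' : frechetObjective K x w z' = L :=
    tendsto_nhds_unique ((hcont z' hz'mem).tendsto.comp
      (tendsto_nhdsWithin_iff.2 ⟨hlim', Eventually.of_forall fun k => hmem _⟩))
      (hL.comp ((tendsto_add_atTop_nat 1).comp hψ.tendsto_atTop))
  obtain ⟨ρ, hρ, h⟩ := frechetObjective_step_add_le hK hx hw hz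
  rw [← hz', hfz, hfz'] at h
  have hfix : z' = z := by
    refine eq_of_mul_lorentzInner_le_one hK hz'mem hz ?_
    by_contra! hc
    have := mul_pos hρ (sub_pos.2 hc)
    linarith
  exact hmin z hz (frechetObjective_le_of_fixed hK hx hw hz hμ hfix)

end FrechetMean

/-- convergence of the hyperboloid-model Fréchet mean algorithm.
Starting at `y 0 = x⁽¹⁾` with updates
`u_{k+1} = ∑ l, w l * φ(−|K|⟨x⁽ˡ⁾, y_k⟩_L) • x⁽ˡ⁾` and
`y_{k+1} = u_{k+1} / √(−|K|⟨u_{k+1}, u_{k+1}⟩_L)`, every iterate lies on the positive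
sheet and the sequence converges to the unique minimizer `μ` of the Fréchet objective. -/
theorem hyperboloid_frechet_mean_algorithm_converges
    (n t : ℕ) (ht : 0 < t) (K : ℝ) (hK : K < 0)
    (x : Fin t → Fin (n + 1) → ℝ)
    (hxsheet : ∀ l, lorentzInner (x l) (x l) = 1 / K ∧ 0 < x l 0)
    (w : Fin t → ℝ) (hw : ∀ l, 0 < w l)
    (f : (Fin (n + 1) → ℝ) → ℝ)
    (hf : ∀ y, f y = ∑ l, (w l / |K|) * (arcosh (K * lorentzInner (x l) y)) ^ 2)
    (μ : Fin (n + 1) → ℝ)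
    (hμsheet : lorentzInner μ μ = 1 / K ∧ 0 < μ 0)
    (hμmin : ∀ y : Fin (n + 1) → ℝ, lorentzInner y y = 1 / K → 0 < y 0 → f μ ≤ f y)
    (hμuniq : ∀ y : Fin (n + 1) → ℝ, lorentzInner y y = 1 / K → 0 < y 0 →
      f y = f μ → y = μ)
    (u y : ℕ → Fin (n + 1) → ℝ)
    (hy0 : y 0 = x ⟨0, ht⟩)
    (hu : ∀ k, u (k + 1) =
      ∑ l, (w l * phiH (-(|K| * lorentzInner (x l) (y k)))) • x l)
    (hy : ∀ k, y (k + 1) =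
      (Real.sqrt (-(|K| * lorentzInner (u (k + 1)) (u (k + 1)))))⁻¹ • u (k + 1)) :
    (∀ k, lorentzInner (y k) (y k) = 1 / K ∧ 0 < y k 0) ∧
    (∀ k, lorentzInner (u (k + 1)) (u (k + 1)) < 0) ∧
    Tendsto y atTop (nhds μ) := by
  have : Nonempty (Fin t) := ⟨⟨0, ht⟩⟩
  have hf' : f = frechetObjective K x w := funext hf
  subst hf'
  have hstep : ∀ k, y (k + 1) = hyperboloidNormalize K (frechetDirection K x w (y k)) :=
    fun k => by rw [hy k, hu k]; rfl
  have hmem : ∀ k, y k ∈ positiveSheet n K := by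
    rintro (_ | k)
    · rw [hy0]; exact hxsheet _
    · rw [hstep]; exact normalize_frechetDirection_mem hK hxsheet hw _
  refine ⟨hmem, fun k => ?_, tendsto_frechet_iteration hK hxsheet hw hμsheet
    (fun z hz h => hμuniq z hz.1 hz.2 (h.antisymm (hμmin z hz.1 hz.2))) hmem hstep⟩
  rw [hu k]
  exact (frechetDirection_timelike hK hxsheet hw (y k)).1
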